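/- arXiv:2302.05737 — 9 statements merged into one kernel-verified Lean document; each statement's English description precedes it below -/
import Mathlib

section
/- Let K ≥ 1 and let q_noise : Fin K → ℝ be a probability vector. Fix reals β_t, α_{t−1}, α_t with α_t = β_t * α_{t−1}, and fix i_0, i_t : Fin K. Define the evidence D = α_t * (if i_t = i_0 then 1 else 0) + (1 − α_t) * q_noise i_t and the conditional backward transition r : Fin K → ℝ by r j = (β_t * (if j = i_t then 1 else 0) + (1 − β_t) * q_noise i_t) * (α_{t−1} * (if j = i_0 then 1 else 0) + (1 − α_{t−1}) * q_noise j) / D. If i_t = i_0 and D ≠ 0, then for every j : Fin K, r j = λ₁ * (Pi.single i_t 1) j + (1 − λ₁) * q_noise j, where λ₁ = 1 − (1 − β_t) * (1 − α_{t−1}) * q_noise i_t / D. -/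
/-- Proposition 1, case `x_t = x_0`: the conditional backward transition
`q(x_{t-1} | x_t, x_0)` of a discrete diffusion process is the mixture
`λ₁ • (one-hot at x_t) + (1 - λ₁) • q_noise`. -/
theorem backward_transition_case_eq
    (K : ℕ) (hK : 1 ≤ K) (q_noise : Fin K → ℝ)
    (hq_nonneg : ∀ j, 0 ≤ q_noise j) (hq_sum : ∑ j, q_noise j = 1)
    (βt αtm1 αt : ℝ) (hα : αt = βt * αtm1)
    (i0 it : Fin K)
    (D : ℝ)
    (hD : D = αt * (if it = i0 then 1 else 0) + (1 - αt) * q_noise it)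
    (r : Fin K → ℝ)
    (hr : ∀ j, r j =
      (βt * (if j = it then 1 else 0) + (1 - βt) * q_noise it) *
        (αtm1 * (if j = i0 then 1 else 0) + (1 - αtm1) * q_noise j) / D)
    (heq : it = i0) (hDne : D ≠ 0) :
    ∀ j, r j =
      (1 - (1 - βt) * (1 - αtm1) * q_noise it / D) * (Pi.single it 1 : Fin K → ℝ) j
        + (1 - (1 - (1 - βt) * (1 - αtm1) * q_noise it / D)) * q_noise j := by
  subst heq hα
  intro j
  rw [hr j]
  by_cases hj : j = it
  · subst hj
    simp only [if_true, mul_one] at hD ⊢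
    rw [Pi.single_eq_same]
    field_simp
    rw [hD]
    ring
  · rw [Pi.single_eq_of_ne hj]
    simp only [hj, if_false]
    ring
end

section
/- Let K ≥ 1 and let q_noise : Fin K → ℝ be a probability vector. Fix reals β_t, α_{t−1}, α_t with α_t = β_t * α_{t−1}, and fix i_0, i_t : Fin K. Define the evidence D = α_t * (if i_t = i_0 then 1 else 0) + (1 − α_t) * q_noise i_t and the conditional backward transition r : Fin K → ℝ by r j = (β_t * (if j = i_t then 1 else 0) + (1 − β_t) * q_noise i_t) * (α_{t−1} * (if j = i_0 then 1 else 0) + (1 − α_{t−1}) * q_noise j) / D. If i_t ≠ i_0, q_noise i_t ≠ 0, and α_t ≠ 1, then for every j : Fin K, r j = λ₂ * (Pi.single i_0 1) j + (1 − λ₂) * (β_t * (Pi.single i_t 1) j + (1 − β_t) * q_noise j), where λ₂ = (α_{t−1} − α_t) / (1 − α_t). -/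
/-- Proposition 1, case `x_t ≠ x_0`: the conditional backward transition
`q(x_{t-1} | x_t, x_0)` of a discrete diffusion process is the mixture
`λ₂ • (one-hot at x_0) + (1 - λ₂) • q_noise(x_t)`, where `q_noise(x_t)` is the
interpolated noise distribution. -/
theorem backward_transition_case_ne
    (K : ℕ) (hK : 1 ≤ K) (q_noise : Fin K → ℝ)
    (hq_nonneg : ∀ j, 0 ≤ q_noise j) (hq_sum : ∑ j, q_noise j = 1)
    (βt αtm1 αt : ℝ) (hα : αt = βt * αtm1)
    (i0 it : Fin K)
    (D : ℝ)
    (hD : D = αt * (if it = i0 then 1 else 0) + (1 - αt) * q_noise it)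
    (r : Fin K → ℝ)
    (hr : ∀ j, r j =
      (βt * (if j = it then 1 else 0) + (1 - βt) * q_noise it) *
        (αtm1 * (if j = i0 then 1 else 0) + (1 - αtm1) * q_noise j) / D)
    (hne : it ≠ i0) (hq_it : q_noise it ≠ 0) (hαt : αt ≠ 1) :
    ∀ j, r j =
      ((αtm1 - αt) / (1 - αt)) * (Pi.single i0 1 : Fin K → ℝ) j
        + (1 - (αtm1 - αt) / (1 - αt)) *
            (βt * (Pi.single it 1 : Fin K → ℝ) j + (1 - βt) * q_noise j) := by
  intro j
  have hα_sub : 1 - βt * αtm1 ≠ 0 := by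
    rw [← hα]
    exact sub_ne_zero.mpr hαt.symm
  rw [hr, hD, if_neg hne, hα]
  simp only [Pi.single_apply, mul_zero, zero_add]
  by_cases hjt : j = it
  · subst hjt
    simp only [if_true, if_neg hne]
    field_simp
    ring
  · simp only [if_neg hjt]
    field_simp
    ring
end

section
/- Let K ≥ 1 and let q_noise : Fin K → ℝ satisfy ∑ j, q_noise j = 1. Fix reals β_t, α_{t−1}, α_t with α_t = β_t * α_{t−1}, and fix i_0, i_t : Fin K. Then ∑ j, (β_t * (if j = i_t then 1 else 0) + (1 − β_t) * q_noise i_t) * (α_{t−1} * (if j = i_0 then 1 else 0) + (1 − α_{t−1}) * q_noise j) = α_t * (if i_t = i_0 then 1 else 0) + (1 − α_t) * q_noise i_t. -/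
/-- Chapman–Kolmogorov evidence identity for discrete diffusion:
`∑_{x_{t-1}} q(x_t | x_{t-1}) q(x_{t-1} | x_0) = q(x_t | x_0)`. -/
theorem chapman_kolmogorov_evidence
    (K : ℕ) (hK : 1 ≤ K) (q_noise : Fin K → ℝ)
    (hq_sum : ∑ j, q_noise j = 1)
    (βt αtm1 αt : ℝ) (hα : αt = βt * αtm1)
    (i0 it : Fin K) :
    ∑ j, (βt * (if j = it then 1 else 0) + (1 - βt) * q_noise it) *
        (αtm1 * (if j = i0 then 1 else 0) + (1 - αtm1) * q_noise j)
      = αt * (if it = i0 then 1 else 0) + (1 - αt) * q_noise it := by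
  have sum_marginal :
      ∑ j, (αtm1 * (if j = i0 then 1 else 0) + (1 - αtm1) * q_noise j) = 1 := by
    rw [Finset.sum_add_distrib, ← Finset.mul_sum, ← Finset.mul_sum, hq_sum]
    simp
  simp_rw [add_mul _ ((1 - βt) * q_noise it), mul_assoc βt]
  rw [Finset.sum_add_distrib, ← Finset.mul_sum, ← Finset.mul_sum, sum_marginal]
  simp only [ite_mul, one_mul, zero_mul, Finset.sum_ite_eq', Finset.mem_univ, if_true]
  rw [hα]
  ring
end

section
/- Let K ≥ 1, let q_noise : Fin K → ℝ satisfy ∑ j, q_noise j = 1, and let N : Matrix (Fin K) (Fin K) ℝ be the matrix with entries N i j = q_noise j. Let β : ℕ → ℝ, let s ≤ t be natural numbers, set α_u = ∏_{i=1}^{u} β i, and assume α_s ≠ 0. Then the ordered matrix product (β (s+1) • 1 + (1 − β (s+1)) • N) * ⋯ * (β t • 1 + (1 − β t) • N) equals (α_t / α_s) • (1 : Matrix (Fin K) (Fin K) ℝ) + (1 − α_t / α_s) • N. -/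
/-- A square matrix whose rows all equal a vector with entries summing to one is idempotent. -/
theorem Matrix.isIdempotentElem_of_rows_eq {n R : Type*} [Fintype n] [NonAssocSemiring R]
    {q : n → R} (hq : ∑ j, q j = 1) {N : Matrix n n R} (hN : ∀ i j, N i j = q j) :
    IsIdempotentElem N := by
  ext i j
  simp only [Matrix.mul_apply, hN, ← Finset.sum_mul, hq, one_mul]

/-- Affine combinations of `1` and an idempotent multiply through their coefficients. -/
theorem IsIdempotentElem.smul_one_add_smul_mul {R A : Type*} [CommRing R] [Ring A] [Algebra R A]
    {e : A} (he : IsIdempotentElem e) (a b : R) :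
    (a • (1 : A) + (1 - a) • e) * (b • (1 : A) + (1 - b) • e)
      = (a * b) • (1 : A) + (1 - a * b) • e := by
  simp only [mul_add, add_mul, smul_mul_smul_comm, one_mul, mul_one, he.eq]
  module

/-- An ordered product of affine combinations of `1` and an idempotent. -/
theorem IsIdempotentElem.list_prod_smul_one_add_smul {R A : Type*} [CommRing R] [Ring A]
    [Algebra R A] {e : A} (he : IsIdempotentElem e) {ι : Type*} (b : ι → R) (l : List ι) :
    (l.map fun i => b i • (1 : A) + (1 - b i) • e).prod
      = (l.map b).prod • (1 : A) + (1 - (l.map b).prod) • e := by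
  induction l with
  | nil => simp
  | cons i l ih => simp only [List.map_cons, List.prod_cons, ih, he.smul_one_add_smul_mul]

/-- Multi-step forward transition of a discrete diffusion process: the ordered product
`(β (s+1) • I + (1 - β (s+1)) • N) * ⋯ * (β t • I + (1 - β t) • N)` equals
`(α_t / α_s) • I + (1 - α_t / α_s) • N`, where `α_u = ∏_{i=1}^u β i` and `α_s ≠ 0`. -/
theorem multi_step_forward_transition
    (K : ℕ) (hK : 1 ≤ K) (q_noise : Fin K → ℝ)
    (hq_sum : ∑ j, q_noise j = 1)
    (N : Matrix (Fin K) (Fin K) ℝ) (hN : ∀ i j, N i j = q_noise j)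
    (β : ℕ → ℝ) (s t : ℕ) (hst : s ≤ t)
    (αs αt : ℝ)
    (hαs : αs = ∏ i ∈ Finset.Icc 1 s, β i)
    (hαt : αt = ∏ i ∈ Finset.Icc 1 t, β i)
    (hαs_ne : αs ≠ 0) :
    ((List.range (t - s)).map (fun i =>
        β (s + 1 + i) • (1 : Matrix (Fin K) (Fin K) ℝ) + (1 - β (s + 1 + i)) • N)).prod
      = (αt / αs) • (1 : Matrix (Fin K) (Fin K) ℝ) + (1 - αt / αs) • N := by
  have hprod : αt = αs * ((List.range (t - s)).map fun i => β (s + 1 + i)).prod := by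
    obtain ⟨d, rfl⟩ := Nat.exists_eq_add_of_le hst
    rw [hαs, hαt, Nat.add_sub_cancel_left,
      ← Finset.Ico_add_one_right_eq_Icc, ← Finset.Ico_add_one_right_eq_Icc,
      ← Finset.prod_Ico_consecutive β (Nat.le_add_left 1 s) (by lia : s + 1 ≤ s + d + 1),
      Finset.prod_Ico_eq_prod_range β (s + 1),
      show s + d + 1 - (s + 1) = d by lia]
    rfl
  rw [(Matrix.isIdempotentElem_of_rows_eq hq_sum hN).list_prod_smul_one_add_smul, hprod,
    mul_div_cancel_left₀ _ hαs_ne]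
end

section
/- Let K ≥ 1 and let q_noise : Fin K → ℝ be a probability vector. Fix reals γ, α_s, α_t with α_t = γ * α_s, and fix i_0, i_t : Fin K. Define D = α_t * (if i_t = i_0 then 1 else 0) + (1 − α_t) * q_noise i_t and r : Fin K → ℝ by r j = (γ * (if j = i_t then 1 else 0) + (1 − γ) * q_noise i_t) * (α_s * (if j = i_0 then 1 else 0) + (1 − α_s) * q_noise j) / D. Then: (a) if i_t = i_0 and D ≠ 0, for every j, r j = λ₁ * (Pi.single i_t 1) j + (1 − λ₁) * q_noise j with λ₁ = 1 − (1 − γ) * (1 − α_s) * q_noise i_t / D; and (b) if i_t ≠ i_0, q_noise i_t ≠ 0, and α_t ≠ 1, for every j, r j = λ₂ * (Pi.single i_0 1) j + (1 − λ₂) * (γ * (Pi.single i_t 1) j + (1 − γ) * q_noise j) with λ₂ = (α_s − α_t) / (1 − α_t). -/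
/-- Generalization of Proposition 1 to backward transitions with an arbitrary time gap:
the Bayes posterior `q(x_s | x_t, x_0)` is (a) `λ₁ • (one-hot at x_t) + (1 - λ₁) • q_noise`
when `x_t = x_0`, and (b) `λ₂ • (one-hot at x_0) + (1 - λ₂) • q_noise(x_t)` when `x_t ≠ x_0`. -/
theorem backward_transition_time_gap
    (K : ℕ) (hK : 1 ≤ K) (q_noise : Fin K → ℝ)
    (hq_nonneg : ∀ j, 0 ≤ q_noise j) (hq_sum : ∑ j, q_noise j = 1)
    (γ αs αt : ℝ) (hα : αt = γ * αs)
    (i0 it : Fin K)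
    (D : ℝ)
    (hD : D = αt * (if it = i0 then 1 else 0) + (1 - αt) * q_noise it)
    (r : Fin K → ℝ)
    (hr : ∀ j, r j =
      (γ * (if j = it then 1 else 0) + (1 - γ) * q_noise it) *
        (αs * (if j = i0 then 1 else 0) + (1 - αs) * q_noise j) / D) :
    (it = i0 → D ≠ 0 →
      ∀ j, r j =
        (1 - (1 - γ) * (1 - αs) * q_noise it / D) * (Pi.single it 1 : Fin K → ℝ) j
          + (1 - (1 - (1 - γ) * (1 - αs) * q_noise it / D)) * q_noise j)
    ∧ (it ≠ i0 → q_noise it ≠ 0 → αt ≠ 1 →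
      ∀ j, r j =
        ((αs - αt) / (1 - αt)) * (Pi.single i0 1 : Fin K → ℝ) j
          + (1 - (αs - αt) / (1 - αt)) *
              (γ * (Pi.single it 1 : Fin K → ℝ) j + (1 - γ) * q_noise j)) := by
  constructor
  · intro h hD0 j
    subst h
    rw [hr j, Pi.single_apply]
    rw [if_pos rfl] at hD
    split_ifs with hj
    · subst hj
      field_simp
      rw [hD, hα]
      ring
    · field_simp
      ring
  · intro h hq ht j
    have ht' : 1 - αt ≠ 0 := sub_ne_zero.mpr ht.symm
    rw [if_neg h, mul_zero, zero_add] at hD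
    rw [hr j, Pi.single_apply, Pi.single_apply, hD]
    by_cases hj : j = it
    · subst hj
      rw [if_pos rfl, if_neg h]
      field_simp
      ring
    · rw [if_neg hj]
      field_simp
      rw [hα]
      ring
end

section
/- Let K ≥ 1, N ≥ 1, and λ₁ λ₂ : ℝ. For each n : Fin N let b n : Bool, i_0 n : Fin K, and f n, m n, c n : Fin K → ℝ. Define KL(a ‖ b) = ∑ j, a j * Real.log (a j / b j). Then ∑ n, (if b n then λ₁ * KL(c n ‖ c n) + (1 − λ₁) * KL(m n ‖ m n) else λ₂ * KL(Pi.single (i_0 n) 1 ‖ f n) + (1 − λ₂) * KL(m n ‖ m n)) = −λ₂ * ∑ n, (if b n then 0 else Real.log (f n (i_0 n))). -/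
/-- The Kullback–Leibler divergence between two finitely supported weight
functions on `Fin K`. -/
noncomputable def klDiv {K : ℕ} (a b : Fin K → ℝ) : ℝ :=
  ∑ j, a j * Real.log (a j / b j)

/-- The divergence of any weight function from itself vanishes. -/
theorem klDiv_self {K : ℕ} (a : Fin K → ℝ) : klDiv a a = 0 := by
  refine Finset.sum_eq_zero fun j _ => ?_
  by_cases h : a j = 0 <;> simp [h]

/-- The divergence of a point mass from `b` is the negative log-weight of `b` at that point. -/
theorem klDiv_single_left {K : ℕ} (i : Fin K) (b : Fin K → ℝ) :
    klDiv (Pi.single i 1) b = -Real.log (b i) := by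
  rw [klDiv, Finset.sum_eq_single i]
  · simp
  · intro j _ hj
    simp [hj]
  · simp

/-- Equation (6), sequence case: the step-`t` training objective of a
reparameterized discrete diffusion model, written as an expectation of KL
divergences over the Bernoulli routing indicators, reduces to a reweighted
cross-entropy loss over the noisy tokens. -/
theorem rdm_loss_eq_reweighted_ce
    (K N : ℕ) (hK : 1 ≤ K) (hN : 1 ≤ N) (lam₁ lam₂ : ℝ)
    (b : Fin N → Bool) (i0 : Fin N → Fin K)
    (f m c : Fin N → Fin K → ℝ) :
    ∑ n, (if b n then
        lam₁ * klDiv (c n) (c n) + (1 - lam₁) * klDiv (m n) (m n)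
      else
        lam₂ * klDiv (Pi.single (i0 n) 1 : Fin K → ℝ) (f n)
          + (1 - lam₂) * klDiv (m n) (m n))
      = -lam₂ * ∑ n, (if b n then 0 else Real.log (f n (i0 n))) := by
  rw [Finset.mul_sum]
  refine Finset.sum_congr rfl fun n _ => ?_
  simp only [klDiv_self, klDiv_single_left]
  split_ifs <;> ring
end

section
/- Let K ≥ 1 and equip Fin K with the uniform noise distribution q_noise j = 1/K. Fix reals β_t, α_{t−1}, α_t with α_t = β_t * α_{t−1}, and fix i_0, i_t : Fin K. Then: (a) for every j : Fin K, (β_t * (if j = i_t then 1 else 0) + (1 − β_t)/K) * (α_{t−1} * (if j = i_0 then 1 else 0) + (1 − α_{t−1})/K) = α_t * (if j = i_t then 1 else 0) * (if j = i_0 then 1 else 0) + (1/K) * β_t * (1 − α_{t−1}) * (if j = i_t then 1 else 0) + (1/K) * (1 − β_t) * α_{t−1} * (if j = i_0 then 1 else 0) + (1/K^2) * (1 − β_t) * (1 − α_{t−1}); and (b) ∑ j, (β_t * (if j = i_t then 1 else 0) + (1 − β_t)/K) * (α_{t−1} * (if j = i_0 then 1 else 0) + (1 − α_{t−1})/K)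 = α_t * (if i_t = i_0 then 1 else 0) + (1/K) * (1 − α_t). -/
/-- Closed-form Bayes numerator and evidence for the backward transition of
multinomial discrete diffusion with uniform noise `q_noise j = 1/K`. -/
theorem multinomial_backward_numerator_and_evidence
    (K : ℕ) (hK : 1 ≤ K)
    (βt αtm1 αt : ℝ) (hα : αt = βt * αtm1)
    (i0 it : Fin K) :
    (∀ j : Fin K,
      (βt * (if j = it then 1 else 0) + (1 - βt) / K) *
          (αtm1 * (if j = i0 then 1 else 0) + (1 - αtm1) / K)
        = αt * (if j = it then 1 else 0) * (if j = i0 then 1 else 0)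
          + (1 / K) * βt * (1 - αtm1) * (if j = it then 1 else 0)
          + (1 / K) * (1 - βt) * αtm1 * (if j = i0 then 1 else 0)
          + (1 / K ^ 2) * (1 - βt) * (1 - αtm1))
    ∧ ∑ j, (βt * (if j = it then 1 else 0) + (1 - βt) / K) *
          (αtm1 * (if j = i0 then 1 else 0) + (1 - αtm1) / K)
        = αt * (if it = i0 then 1 else 0) + (1 / K) * (1 - αt) := by
  subst hα
  refine ⟨fun j => by ring, ?_⟩
  have hK0 : (K : ℝ) ≠ 0 := by positivity
  simp only [add_mul, mul_add, Finset.sum_add_distrib, mul_ite, ite_mul, mul_one, mul_zero,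
    zero_mul, Finset.sum_ite_eq', Finset.sum_const, Finset.card_univ, Fintype.card_fin,
    nsmul_eq_mul, Finset.mem_univ, if_true, eq_comm (a := i0)]
  split_ifs <;> field_simp <;> ring
end

section
/- Let K ≥ 1, T ≥ 2, and i_0 : Fin K. For 1 ≤ t ≤ T let qM t : Fin K → ℝ be probability vectors; for 2 ≤ t ≤ T let qB t : Fin K → Fin K → ℝ with qB t i a probability vector for each i; let pT : Fin K → ℝ be a probability vector, and for 1 ≤ t ≤ T let pB t : Fin K → Fin K → ℝ with pB t i a probability vector for each i. Assume (i) for all 2 ≤ t ≤ T and all j, ∑ i, qM t i * qB t i j = qM (t−1) j, and (ii) qM t i > 0, qB t i j > 0, pB t i j > 0, and pT i > 0 for all relevant indices. For a trajectory x = (x_1, …, x_T) ∈ (Fin K)^T define Q(x) = qM T x_T * ∏_{t=2}^{T} qB t x_t x_{t−1} and P(x) = pT x_T * (∏_{t=2}^{T} pB t x_t x_{t−1}) * pB 1 x_1 i_0. Then ∑_{x ∈ (Fin K)^T} Q(x) * Real.log (P(x) / Q(x)) = ∑ i, qM 1 i * Real.log (pB 1 i i_0) − ∑_{t=2}^{T}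 ∑ i, qM t i * (∑ j, qB t i j * Real.log (qB t i j / pB t i j)) − ∑ i, qM T i * Real.log (qM T i / pT i). -/
/-- For a trajectory `x : Fin T → Fin K` (with `0 < T`), `trajGet x hT t` is the state
`x_t` of the trajectory at time `t`, for `1 ≤ t ≤ T` (time `t` is stored at index `t - 1`). -/
def trajGet {T K : ℕ} (x : Fin T → Fin K) (hT : 0 < T) (t : ℕ) : Fin K :=
  x ⟨(t - 1) % T, Nat.mod_lt _ hT⟩

@[to_additive]
theorem Finset.prod_Icc_two_eq_prod_fin {M : Type*} [CommMonoid M] (f : ℕ → M) (n : ℕ) :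
    ∏ t ∈ Finset.Icc 2 (n + 1), f t = ∏ s : Fin n, f (s + 2) := by
  induction n with
  | zero => simp
  | succ n ih =>
    rw [Finset.prod_Icc_succ_top (by omega), ih, Fin.prod_univ_castSucc]
    simp

/-- Expectation of an additive functional of a backward Markov chain with marginals `M s` and
backward transitions `B s i`, indexed by trajectories `x : Fin (n + 1) → α`. -/
theorem sum_backward_chain_mul_additive {α : Type*} [Fintype α] (n : ℕ)
    (M : ℕ → α → ℝ) (B ℓ : ℕ → α → α → ℝ) (a e : α → ℝ)
    (hB : ∀ s < n, ∀ i, ∑ j, B s i j = 1)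
    (hM : ∀ s < n, ∀ j, ∑ i, M (s + 1) i * B s i j = M s j) :
    ∑ x : Fin (n + 1) → α,
        (M n (x (Fin.last n)) * ∏ s : Fin n, B s (x s.succ) (x s.castSucc)) *
          (a (x 0) + ∑ s : Fin n, ℓ s (x s.succ) (x s.castSucc) + e (x (Fin.last n)))
      = ∑ i, M 0 i * a i + ∑ s : Fin n, ∑ i, M (s + 1) i * (∑ j, B s i j * ℓ s i j)
        + ∑ i, M n i * e i := by
  induction n generalizing M B ℓ a with
  | zero =>
    rw [← (Equiv.funUnique (Fin 1) α).symm.sum_comp]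
    simp [mul_add, Finset.sum_add_distrib]
  | succ n ih =>
    have key := ih (fun s => M (s + 1)) (fun s => B (s + 1)) (fun s => ℓ (s + 1))
      (fun i => ∑ j, B 0 i j * (a j + ℓ 0 i j))
      (fun s hs => hB (s + 1) (by omega)) (fun s hs => hM (s + 1) (by omega))
    have hfirst : ∑ i, M 1 i * ∑ j, B 0 i j * (a j + ℓ 0 i j)
        = ∑ j, M 0 j * a j + ∑ i, M 1 i * ∑ j, B 0 i j * ℓ 0 i j := by
      simp_rw [mul_add, Finset.sum_add_distrib, mul_add, Finset.sum_add_distrib]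
      congr 1
      simp_rw [Finset.mul_sum]
      rw [Finset.sum_comm]
      refine Finset.sum_congr rfl fun j _ => ?_
      rw [← hM 0 (by omega) j, Finset.sum_mul]
      exact Finset.sum_congr rfl fun i _ => by ring
    rw [← (Fin.consEquiv fun _ : Fin (n + 2) => α).sum_comp, Fintype.sum_prod_type,
      Finset.sum_comm, Fin.sum_univ_succ]
    simp only [zero_add, Fin.val_zero, Fin.val_succ] at key hfirst ⊢
    rw [← add_assoc, ← hfirst, ← key]
    refine Finset.sum_congr rfl fun y _ => ?_
    simp only [Fin.consEquiv_apply, Fin.prod_univ_succ, Fin.sum_univ_succ, ← Fin.succ_last,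
      Fin.castSucc_zero, ← Fin.succ_castSucc, Fin.cons_succ, Fin.cons_zero, Fin.val_zero,
      Fin.val_succ]
    set R := ∑ s : Fin n, ℓ (s + 1) (y s.succ) (y s.castSucc)
    set P := ∏ s : Fin n, B (s + 1) (y s.succ) (y s.castSucc)
    have hsplit : ∑ j, B 0 (y 0) j * (a j + ℓ 0 (y 0) j) + R + e (y (Fin.last n))
        = ∑ j, B 0 (y 0) j * (a j + ℓ 0 (y 0) j + R + e (y (Fin.last n))) := by
      have h1 := hB 0 (by omega) (y 0)
      simp only [mul_add, Finset.sum_add_distrib, ← Finset.sum_mul, h1]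
      ring
    rw [hsplit, Finset.mul_sum]
    exact Finset.sum_congr rfl fun j _ => by ring

theorem Real.log_mul_prod_mul_div_mul_prod {ι : Type*} (s : Finset ι) {u v w : ℝ} {f g : ι → ℝ}
    (hu : 0 < u) (hv : 0 < v) (hw : 0 < w) (hf : ∀ i ∈ s, 0 < f i) (hg : ∀ i ∈ s, 0 < g i) :
    Real.log ((u * (∏ i ∈ s, f i) * v) / (w * ∏ i ∈ s, g i))
      = Real.log v + ∑ i ∈ s, -Real.log (g i / f i) + -Real.log (w / u) := by
  have hF := Finset.prod_pos hf
  have hG := Finset.prod_pos hg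
  have hsum : ∑ i ∈ s, -Real.log (g i / f i)
      = ∑ i ∈ s, Real.log (f i) - ∑ i ∈ s, Real.log (g i) := by
    rw [← Finset.sum_sub_distrib]
    refine Finset.sum_congr rfl fun i hi => ?_
    rw [Real.log_div (hg i hi).ne' (hf i hi).ne']
    ring
  rw [hsum, Real.log_div (by positivity) (by positivity), Real.log_mul (by positivity) hv.ne',
    Real.log_mul hu.ne' hF.ne', Real.log_mul hw.ne' hG.ne', Real.log_div hw.ne' hu.ne',
    Real.log_prod fun i hi => (hf i hi).ne', Real.log_prod fun i hi => (hg i hi).ne']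
  ring

/-- Decomposition of the evidence lower bound of discrete diffusion models:
`E_Q[log (P/Q)] = L₁ - ∑_{t=2}^T L_t - KL(q(x_T | x_0) ‖ p(x_T))`, where `Q` is the
variational posterior over trajectories `(x_1, …, x_T)` and `P` is the joint model
probability of `(x_0 = i₀, x_1, …, x_T)`. -/
theorem elbo_decomposition
    (K T : ℕ) (hK : 1 ≤ K) (hT : 2 ≤ T) (i0 : Fin K)
    (qM : ℕ → Fin K → ℝ) (qB : ℕ → Fin K → Fin K → ℝ)
    (pT : Fin K → ℝ) (pB : ℕ → Fin K → Fin K → ℝ)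
    (hqM : ∀ t, 1 ≤ t → t ≤ T → (∀ j, 0 ≤ qM t j) ∧ ∑ j, qM t j = 1)
    (hqB : ∀ t, 2 ≤ t → t ≤ T → ∀ i, (∀ j, 0 ≤ qB t i j) ∧ ∑ j, qB t i j = 1)
    (hpT : (∀ j, 0 ≤ pT j) ∧ ∑ j, pT j = 1)
    (hpB : ∀ t, 1 ≤ t → t ≤ T → ∀ i, (∀ j, 0 ≤ pB t i j) ∧ ∑ j, pB t i j = 1)
    (hmarg : ∀ t, 2 ≤ t → t ≤ T → ∀ j, ∑ i, qM t i * qB t i j = qM (t - 1) j)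
    (hqM_pos : ∀ t, 1 ≤ t → t ≤ T → ∀ i, 0 < qM t i)
    (hqB_pos : ∀ t, 2 ≤ t → t ≤ T → ∀ i j, 0 < qB t i j)
    (hpB_pos : ∀ t, 1 ≤ t → t ≤ T → ∀ i j, 0 < pB t i j)
    (hpT_pos : ∀ i, 0 < pT i) :
    ∑ x : Fin T → Fin K,
        (qM T (trajGet x (by omega) T) *
            ∏ t ∈ Finset.Icc 2 T, qB t (trajGet x (by omega) t) (trajGet x (by omega) (t - 1))) *
          Real.log
            ((pT (trajGet x (by omega) T) *
                (∏ t ∈ Finset.Icc 2 T,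
                  pB t (trajGet x (by omega) t) (trajGet x (by omega) (t - 1))) *
                pB 1 (trajGet x (by omega) 1) i0) /
              (qM T (trajGet x (by omega) T) *
                ∏ t ∈ Finset.Icc 2 T,
                  qB t (trajGet x (by omega) t) (trajGet x (by omega) (t - 1))))
      = ∑ i, qM 1 i * Real.log (pB 1 i i0)
        - ∑ t ∈ Finset.Icc 2 T,
            ∑ i, qM t i * (∑ j, qB t i j * Real.log (qB t i j / pB t i j))
        - ∑ i, qM T i * Real.log (qM T i / pT i) := by
  obtain ⟨n, rfl⟩ : ∃ n, T = n + 1 := ⟨T - 1, by omega⟩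
  have hget : ∀ (x : Fin (n + 1) → Fin K) (h : 0 < n + 1) (s : Fin (n + 1)),
      trajGet x h (s + 1) = x s := fun x h s => by
    simp only [trajGet, Nat.add_sub_cancel, Nat.mod_eq_of_lt s.isLt]
  have hlast : ∀ (x : Fin (n + 1) → Fin K) (h : 0 < n + 1),
      trajGet x h (n + 1) = x (Fin.last n) := fun x h => hget x h (Fin.last n)
  have hzero : ∀ (x : Fin (n + 1) → Fin K) (h : 0 < n + 1),
      trajGet x h 1 = x 0 := fun x h => hget x h 0
  have hsucc : ∀ (x : Fin (n + 1) → Fin K) (h : 0 < n + 1) (s : Fin n),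
      trajGet x h (s + 2) = x s.succ := fun x h s => hget x h s.succ
  have hcast : ∀ (x : Fin (n + 1) → Fin K) (h : 0 < n + 1) (s : Fin n),
      trajGet x h (s + 2 - 1) = x s.castSucc := fun x h s => hget x h s.castSucc
  simp only [Finset.prod_Icc_two_eq_prod_fin, Finset.sum_Icc_two_eq_sum_fin, hlast, hzero,
    hsucc, hcast]
  have key := sum_backward_chain_mul_additive n (fun s => qM (s + 1)) (fun s => qB (s + 2))
    (fun s i j => -Real.log (qB (s + 2) i j / pB (s + 2) i j))
    (fun i => Real.log (pB 1 i i0)) (fun i => -Real.log (qM (n + 1) i / pT i))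
    (fun s hs i => (hqB (s + 2) (by omega) (by omega) i).2)
    (fun s hs j => hmarg (s + 2) (by omega) (by omega) j)
  simp only [mul_neg, Finset.sum_neg_distrib, ← sub_eq_add_neg, zero_add] at key
  refine Eq.trans (Finset.sum_congr rfl fun x _ => ?_) key
  rw [Real.log_mul_prod_mul_div_mul_prod (Finset.univ : Finset (Fin n)) (hpT_pos _)
    (hpB_pos 1 le_rfl (by omega) _ _)
    (hqM_pos (n + 1) (by omega) le_rfl _)
    (fun s _ => hpB_pos (s + 2) (by omega) (by omega) (x s.succ) (x s.castSucc))
    (fun s _ => hqB_pos (s + 2) (by omega) (by omega) (x s.succ) (x s.castSucc))]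
  simp only [Finset.sum_neg_distrib, ← sub_eq_add_neg]
end

section
/- Let K ≥ 2, fix a mask state M : Fin K, reals β_t, α_{t−1}, α_t with α_t = β_t * α_{t−1}, and a function f : Fin K → ℝ with ∑ k, f k = 1 and f M = 0. For i_t : Fin K define g : Fin K → ℝ by g j = ∑ k, (β_t * (if j = i_t then 1 else 0) + (1 − β_t) * (if i_t = M then 1 else 0)) * (α_{t−1} * (if j = k then 1 else 0) + (1 − α_{t−1}) * (if j = M then 1 else 0)) * f k. Then: (a) if i_t ≠ M, g = (α_t * f i_t) • (Pi.single i_t 1); and (b) if i_t = M, then g M = 1 − α_{t−1}, g k = (α_{t−1} − α_t) * f k for every k ≠ M, and ∑ j, g j = 1 − α_t. -/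
/-- Summing the absorbing marginal against a distribution of total mass one. -/
theorem sum_absorbing_marginal_mul {ι : Type*} [Fintype ι] [DecidableEq ι]
    (M j : ι) (a c : ℝ) (f : ι → ℝ) (hf_sum : ∑ k, f k = 1) :
    ∑ k, c * (a * (if j = k then 1 else 0) + (1 - a) * (if j = M then 1 else 0)) * f k =
      c * (a * f j + (1 - a) * (if j = M then 1 else 0)) := by
  simp_rw [mul_assoc c, add_mul]
  rw [← Finset.mul_sum, Finset.sum_add_distrib, ← Finset.mul_sum, hf_sum]
  simp

/-- Closed form of the D3PM parameterization of the backward transition in absorbing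
diffusion: with `g j = ∑_{x̃₀} q(x_t | x_{t-1} = j) q(x_{t-1} = j | x̃₀) f x̃₀`,
(a) if `x_t ≠ M` then `g` is `(α_t * f x_t) • (one-hot at x_t)`; and (b) if `x_t = M`
then `g M = 1 - α_{t-1}`, `g k = (α_{t-1} - α_t) * f k` for `k ≠ M`, and `∑ j, g j = 1 - α_t`. -/
theorem d3pm_absorbing_backward_closed_form
    (K : ℕ) (hK : 2 ≤ K) (M : Fin K)
    (βt αtm1 αt : ℝ) (hα : αt = βt * αtm1)
    (f : Fin K → ℝ) (hf_sum : ∑ k, f k = 1) (hfM : f M = 0)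
    (g : Fin K → Fin K → ℝ)
    (hg : ∀ it j, g it j =
      ∑ k, (βt * (if j = it then 1 else 0) + (1 - βt) * (if it = M then 1 else 0)) *
        (αtm1 * (if j = k then 1 else 0) + (1 - αtm1) * (if j = M then 1 else 0)) * f k) :
    (∀ it, it ≠ M → g it = (αt * f it) • (Pi.single it 1 : Fin K → ℝ))
    ∧ (∀ it, it = M →
        g it M = 1 - αtm1
        ∧ (∀ k, k ≠ M → g it k = (αtm1 - αt) * f k)
        ∧ ∑ j, g it j = 1 - αt) := by
  simp_rw [sum_absorbing_marginal_mul M _ αtm1 _ f hf_sum] at hg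
  subst hα
  refine ⟨fun it hit => ?_, ?_⟩
  · ext j
    rw [hg]
    by_cases hj : j = it
    · subst hj
      simp [hit, mul_assoc]
    · simp [hj, hit]
  · rintro it rfl
    have hmask : g it it = 1 - αtm1 := by simp [hg, hfM]
    have hother : ∀ k, k ≠ it → g it k = (αtm1 - βt * αtm1) * f k := by
      intro k hk
      simp only [hg, hk, if_true, if_false]
      ring
    refine ⟨hmask, hother, ?_⟩
    have hrest : ∑ k ∈ Finset.univ.erase it, f k = 1 := by
      rw [Finset.sum_erase _ hfM, hf_sum]
    rw [← Finset.add_sum_erase _ _ (Finset.mem_univ it), hmask,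
      Finset.sum_congr rfl fun k hk => hother k (Finset.ne_of_mem_erase hk),
      ← Finset.mul_sum, hrest]
    ring
end
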